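/- The initial value problem y' = F(x,y), y(0) = 0, with continuous right-hand side F on [−1,1] × ℝ such that F(x,·) is Lipschitz continuous for every fixed x ∈ [−1,1], admits two solutions that differ on [0,ε] for every ε > 0: ψ₁(x) = x²/4 for x ≥ 0, ψ₁(x) = 0 for x < 0 (on [−1,1]), and ψ₂(x) = 3x²/2 for x ≥ 0, ψ₂(x) = 0 for x < 0 (on [−1,(2/3)^{1/2}]). -/

import Mathlib

open Set

/-- The piecewise right-hand side of Example 1:
`f(x,y) = x/2` if `y ≤ x²/2`, `f(x,y) = x/2 + 5(y - x²/2)/x` if `x²/2 < y < x²`,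
and `f(x,y) = 3x` if `y ≥ x²`.  (For `x = 0` the middle region is empty and
`f(0,y) = 0` for all `y ≥ 0`.) -/
noncomputable def f (x y : ℝ) : ℝ :=
  if y ≤ x ^ 2 / 2 then x / 2
  else if y < x ^ 2 then x / 2 + 5 * (y - x ^ 2 / 2) / x
  else 3 * x

/-- The extension `F : [−1,1] × ℝ → ℝ`:
`F(x,y) = 0` if `x < 0`; `F(x,y) = x/2` if `x ≥ 0` and `y < 0`;
`F(x,y) = f(x,y)` if `x ≥ 0` and `y ≥ 0`. -/
noncomputable def F (x y : ℝ) : ℝ :=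
  if x < 0 then 0 else if y < 0 then x / 2 else f x y

/-- For `x > 0` the right-hand side is a clamped affine function of `y`. -/
theorem F_eq_clamp {x : ℝ} (hx : 0 < x) (y : ℝ) :
    F x y = x / 2 + 5 / x * max 0 (min (y - x ^ 2 / 2) (x ^ 2 / 2)) := by
  have hx2 : 0 < x ^ 2 := by positivity
  unfold F f
  rw [if_neg hx.not_gt]
  split_ifs with h₁ h₂ h₃
  · rw [min_eq_left (by linarith), max_eq_left (by linarith)]; ring
  · rw [min_eq_left (by linarith), max_eq_left (by linarith)]; ring
  · rw [min_eq_left (by linarith), max_eq_right (by linarith)]; ring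
  · rw [min_eq_right (by linarith), max_eq_right (by linarith)]; field_simp; norm_num

theorem F_of_neg {x : ℝ} (hx : x < 0) (y : ℝ) : F x y = 0 := if_pos hx

theorem F_zero_left (y : ℝ) : F 0 y = 0 := by
  unfold F f
  split_ifs <;> simp

theorem abs_F_le (x y : ℝ) : |F x y| ≤ 3 * |x| := by
  rcases lt_trichotomy x 0 with hx | rfl | hx
  · simp [F_of_neg hx]
  · simp [F_zero_left]
  · have h₀ : 0 ≤ 5 / x * max 0 (min (y - x ^ 2 / 2) (x ^ 2 / 2)) := by positivity
    have h₁ : 5 / x * max 0 (min (y - x ^ 2 / 2) (x ^ 2 / 2)) ≤ 5 / x * (x ^ 2 / 2) := by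
      gcongr
      exact max_le (by positivity) (min_le_right _ _)
    have h₂ : 5 / x * (x ^ 2 / 2) = 5 * x / 2 := by field_simp
    rw [F_eq_clamp hx, abs_of_pos hx, abs_of_nonneg (by positivity)]
    linarith

theorem continuous_F : Continuous fun p : ℝ × ℝ => F p.1 p.2 := by
  rw [continuous_iff_continuousAt]
  rintro ⟨x, y⟩
  rcases lt_trichotomy x 0 with hx | rfl | hx
  · have h : (fun p : ℝ × ℝ => F p.1 p.2) =ᶠ[nhds (x, y)] fun _ => 0 := by
      filter_upwards [continuous_fst.continuousAt.eventually_lt_const hx] with p hp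
      exact F_of_neg hp _
    exact continuousAt_const.congr h.symm
  · have h : Filter.Tendsto (fun p : ℝ × ℝ => 3 * |p.1|) (nhds (0, y)) (nhds 0) := by
      have : Continuous fun p : ℝ × ℝ => 3 * |p.1| := by fun_prop
      simpa using this.tendsto (0, y)
    simpa [ContinuousAt, F_zero_left] using
      squeeze_zero_norm (fun p : ℝ × ℝ => abs_F_le p.1 p.2) h
  · have h : (fun p : ℝ × ℝ => F p.1 p.2) =ᶠ[nhds (x, y)] fun p =>
        p.1 / 2 + 5 / p.1 * max 0 (min (p.2 - p.1 ^ 2 / 2) (p.1 ^ 2 / 2)) := by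
      filter_upwards [continuous_fst.continuousAt.eventually_const_lt hx] with p hp
      exact F_eq_clamp hp _
    refine ContinuousAt.congr ?_ h.symm
    have hdiv : ContinuousAt (fun p : ℝ × ℝ => 5 / p.1) (x, y) :=
      continuousAt_const.div continuousAt_fst hx.ne'
    exact (by fun_prop : ContinuousAt (fun p : ℝ × ℝ => p.1 / 2) (x, y)).add
      (hdiv.mul (by fun_prop))

theorem exists_lipschitz_F (x : ℝ) :
    ∃ L : ℝ, 0 < L ∧ ∀ y₁ y₂ : ℝ, |F x y₁ - F x y₂| ≤ L * |y₁ - y₂| := by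
  rcases lt_trichotomy x 0 with hx | rfl | hx
  · exact ⟨1, one_pos, fun _ _ => by simp [F_of_neg hx]⟩
  · exact ⟨1, one_pos, fun _ _ => by simp [F_zero_left]⟩
  · refine ⟨5 / x, by positivity, fun y₁ y₂ => ?_⟩
    rw [F_eq_clamp hx, F_eq_clamp hx, add_sub_add_left_eq_sub, ← mul_sub, abs_mul,
      abs_of_pos (by positivity : 0 < 5 / x)]
    refine mul_le_mul_of_nonneg_left ?_ (by positivity)
    calc |max 0 (min (y₁ - x ^ 2 / 2) (x ^ 2 / 2)) - max 0 (min (y₂ - x ^ 2 / 2) (x ^ 2 / 2))|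
        ≤ |min (y₁ - x ^ 2 / 2) (x ^ 2 / 2) - min (y₂ - x ^ 2 / 2) (x ^ 2 / 2)| := by
          simpa only [max_comm (0 : ℝ)] using abs_max_sub_max_le_abs
            (min (y₁ - x ^ 2 / 2) (x ^ 2 / 2)) (min (y₂ - x ^ 2 / 2) (x ^ 2 / 2)) 0
      _ ≤ |y₁ - y₂| := by
          have h := abs_min_sub_min_le_max (y₁ - x ^ 2 / 2) (x ^ 2 / 2) (y₂ - x ^ 2 / 2) (x ^ 2 / 2)
          rwa [sub_sub_sub_cancel_right, sub_self, abs_zero, max_eq_left (abs_nonneg _)] at h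

theorem hasDerivAt_ite_mul_sq (c x : ℝ) :
    HasDerivAt (fun t : ℝ => if t < 0 then 0 else c * t ^ 2)
      (if x < 0 then 0 else 2 * c * x) x := by
  have hsq : HasDerivAt (fun t : ℝ => c * t ^ 2) (2 * c * x) x := by
    refine ((hasDerivAt_pow 2 x).const_mul c).congr_deriv ?_
    push_cast
    ring
  rcases lt_trichotomy x 0 with hx | rfl | hx
  · rw [if_pos hx]
    refine (hasDerivAt_const x (0 : ℝ)).congr_of_eventuallyEq ?_
    filter_upwards [eventually_lt_nhds hx] with t ht
    exact if_pos ht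
  · have hleft : HasDerivWithinAt (fun t : ℝ => if t < 0 then 0 else c * t ^ 2) 0 (Iic 0) 0 := by
      refine (hasDerivWithinAt_const (0 : ℝ) (Iic 0) (0 : ℝ)).congr (fun t ht => ?_) (by simp)
      rcases (mem_Iic.mp ht).lt_or_eq with h | rfl
      · exact if_pos h
      · simp
    have hright : HasDerivWithinAt (fun t : ℝ => if t < 0 then 0 else c * t ^ 2) 0 (Ici 0) 0 := by
      rw [mul_zero] at hsq
      exact hsq.hasDerivWithinAt.congr (fun t ht => if_neg (mem_Ici.mp ht).not_gt) (by simp)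
    simpa [Iic_union_Ici] using hleft.union hright
  · rw [if_neg hx.not_gt]
    refine hsq.congr_of_eventuallyEq ?_
    filter_upwards [eventually_gt_nhds hx] with t ht
    exact if_neg ht.not_gt

theorem F_of_le_half_sq {x y : ℝ} (hx : 0 ≤ x) (hy : y ≤ x ^ 2 / 2) : F x y = x / 2 := by
  simp [F, f, hx.not_gt, hy]

theorem F_of_sq_le {x y : ℝ} (hx : 0 ≤ x) (hy : x ^ 2 ≤ y) : F x y = 3 * x := by
  rcases hx.eq_or_lt with rfl | hx
  · simp [F_zero_left]
  · have hx2 : 0 < x ^ 2 := by positivity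
    rw [F, if_neg hx.not_gt, if_neg (by linarith), f, if_neg (by linarith), if_neg (by linarith)]

/-- The IVP `y' = F(x,y)`, `y(0) = 0`, with continuous right-hand side `F` on
`[−1,1] × ℝ` such that `F(x,·)` is Lipschitz continuous for every fixed `x`,
admits two solutions `ψ₁` (on `[−1,1]`) and `ψ₂` (on `[−1,(2/3)^{1/2}]`) that
differ on `[0,ε]` for every `ε > 0`. -/
theorem two_solutions_compact_domain :
    ContinuousOn (fun p : ℝ × ℝ => F p.1 p.2) (Set.Icc (-1:ℝ) 1 ×ˢ Set.univ) ∧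
    (∀ x ∈ Set.Icc (-1:ℝ) 1, ∃ L : ℝ, 0 < L ∧
      ∀ y₁ y₂ : ℝ, |F x y₁ - F x y₂| ≤ L * |y₁ - y₂|) ∧
    ∃ ψ₁ ψ₂ : ℝ → ℝ,
      ψ₁ = (fun x => if x < 0 then 0 else x ^ 2 / 4) ∧
      ψ₂ = (fun x => if x < 0 then 0 else 3 * x ^ 2 / 2) ∧
      ψ₁ 0 = 0 ∧ ψ₂ 0 = 0 ∧
      (∀ x ∈ Set.Icc (-1:ℝ) 1,
        HasDerivWithinAt ψ₁ (F x (ψ₁ x)) (Set.Icc (-1:ℝ) 1) x) ∧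
      (∀ x ∈ Set.Icc (-1:ℝ) (Real.sqrt (2 / 3)),
        HasDerivWithinAt ψ₂ (F x (ψ₂ x)) (Set.Icc (-1:ℝ) (Real.sqrt (2 / 3))) x) ∧
      ∀ ε : ℝ, 0 < ε → ¬ Set.EqOn ψ₁ ψ₂ (Set.Icc (0:ℝ) ε) := by
  refine ⟨continuous_F.continuousOn, fun x _ => exists_lipschitz_F x, _, _, rfl, rfl,
    by simp, by simp, fun x _ => ?_, fun x _ => ?_, fun ε hε h => ?_⟩
  · refine ((hasDerivAt_ite_mul_sq (1 / 4) x).hasDerivWithinAt.congr_deriv ?_).congr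
      (fun t _ => ?_) ?_
    · symm
      split_ifs with hx
      · exact F_of_neg hx _
      · rw [F_of_le_half_sq (not_lt.mp hx) (by linarith [sq_nonneg x])]
        ring
    · split_ifs <;> ring
    · split_ifs <;> ring
  · refine ((hasDerivAt_ite_mul_sq (3 / 2) x).hasDerivWithinAt.congr_deriv ?_).congr
      (fun t _ => ?_) ?_
    · symm
      split_ifs with hx
      · exact F_of_neg hx _
      · rw [F_of_sq_le (not_lt.mp hx) (by linarith [sq_nonneg x])]
        ring
    · split_ifs <;> ring
    · split_ifs <;> ring
  · have hεε := h (right_mem_Icc.mpr hε.le)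
    simp only [if_neg hε.not_gt] at hεε
    have : 0 < ε ^ 2 := by positivity
    linarith
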